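/- If ⊨ is a structural multi-conclusion consequence relation on sets of sentences (satisfying Ref, Weak, Contr, Trans) for a non-trivial logic, → is a conditional satisfying the deduction theorem for ⊨, ⊨ satisfies the naive truth rules (TL) and (TR), and there exists a sentence κ identical to (T⌜κ⌝ → ⊥), then ⊨ ⊥; hence no non-trivial logic with a structural consequence relation and a conditional satisfying the deduction theorem can have a naive consequence relation. -/

import Mathlib

set_option autoImplicit false
/-- **Curry's paradox** (Proposition 1 of the paper).  If `⊨` is a structural
multi-conclusion consequence relation (satisfying Ref, Weak, Contr, Trans), `→` satisfies
the deduction theorem for `⊨`, `⊨` is naive (satisfies (TL) and (TR)), and there is a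
sentence `κ` identical to `T⌜κ⌝ → ⊥`, then `⊨ ⊥`: the logic is trivial.  Hence no
non-trivial logic with a structural consequence relation and a conditional satisfying the
deduction theorem can have a naive consequence relation. -/
theorem curry_paradox {S : Type} (bot : S) (imp : S → S → S) (Tq : S → S)
    (Cons : Set S → Set S → Prop)
    (ref : ∀ (Γ Δ : Set S) (φ : S), Cons (insert φ Γ) (insert φ Δ))
    (weak : ∀ (Γ Δ Γ' Δ' : Set S), Cons Γ Δ → Cons (Γ ∪ Γ') (Δ ∪ Δ'))
    (contr : ∀ (Γ Δ : Set S) (φ : S), Cons (insert φ (insert φ Γ)) Δ → Cons (insert φ Γ) Δ)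
    (trans : ∀ (Γ Δ : Set S) (φ : S), Cons Γ (insert φ Δ) → Cons (insert φ Γ) Δ → Cons Γ Δ)
    (ded : ∀ (Γ : Set S) (φ ψ : S), Cons (insert φ Γ) {ψ} ↔ Cons Γ {imp φ ψ})
    (tl : ∀ (Γ Δ : Set S) (φ : S), Cons (insert φ Γ) Δ ↔ Cons (insert (Tq φ) Γ) Δ)
    (tr : ∀ (Γ Δ : Set S) (φ : S), Cons Γ (insert φ Δ) ↔ Cons Γ (insert (Tq φ) Δ))
    (κ : S) (hκ : κ = imp (Tq κ) bot) :
    Cons ∅ {bot} := by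
  have ded' : ∀ Γ : Set S, Cons (insert (Tq κ) Γ) {bot} ↔ Cons Γ {κ} := by
    intro Γ
    have h := ded Γ (Tq κ) bot
    rwa [← hκ] at h
  have h1 : Cons (insert κ ∅) {κ} := by
    have h := ref ∅ ∅ κ
    rwa [insert_empty_eq κ] at h ⊢
  have h2 : Cons (insert κ ∅) {bot} :=
    contr _ _ _ ((tl _ _ _).2 ((ded' _).2 h1))
  have h3 : Cons ∅ {κ} := (ded' _).1 ((tl _ _ _).1 h2)
  have h4 : Cons ∅ (insert κ {bot}) := by
    have h := weak ∅ {κ} ∅ {bot} h3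
    rwa [Set.union_empty, Set.singleton_union] at h
  exact trans _ _ _ h4 h2
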